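/- Let ℓ satisfy Assumption A. Consider the two-dimensional classification objective L(w) = (1/N) Σ_{i=1}^N ℓ(−y_i x_iᵀw) with N = m₁ + n₁ + m₂ + n₂, all labels y_i = 1, and features consisting of m₁ copies of e₁, n₁ copies of −e₁, m₂ copies of e₂, and n₂ copies of −e₂; suppose the minimizer w* = (w₁*, w₂*) satisfies w₁* > w₂* > 0. Then for every γ ∈ (0,1] there exists a choice of positive integers m₁, n₁, m₂, n₂ such that, with step size η = γ/λ_max(∇²L(w*)) and GD map T(w) = w − η∇L(w), there exists a point w = (w₁, w₂) with w₁ > w₁*, w₂ > w₂*, and w₂*/w₁* > w₂/w₁, for which T(w) satisfies w₂*/w₁* < T(w)₂/T(w)₁ and T(w)₁ > w₁*. -/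

import Mathlib

open Filter Topology

/-- Assumption A on the individual loss function `ℓ`:
(i) `ℓ` is nonnegative, three-times continuously differentiable, strictly convex,
and tends to `0` at `-∞`;
(ii) `ℓ'` tends to `0` at `-∞` and to `1` at `+∞`;
(iii) `ℓ''` is increasing on `(-∞, 0]`, decreasing on `[0, ∞)`, and
`(1/ε²)·ℓ''(1/ε) → 0` as `ε → 0`. -/
structure AssumptionA (ℓ : ℝ → ℝ) : Prop where
  nonneg : ∀ z, 0 ≤ ℓ z
  smooth : ContDiff ℝ 3 ℓ
  strictConvex : StrictConvexOn ℝ Set.univ ℓ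
  tendsto_zero_atBot : Tendsto ℓ atBot (𝓝 0)
  deriv_tendsto_zero_atBot : Tendsto (deriv ℓ) atBot (𝓝 0)
  deriv_tendsto_one_atTop : Tendsto (deriv ℓ) atTop (𝓝 1)
  secondDeriv_strictMono : StrictMonoOn (deriv (deriv ℓ)) (Set.Iic 0)
  secondDeriv_strictAnti : StrictAntiOn (deriv (deriv ℓ)) (Set.Ici 0)
  secondDeriv_decay :
    Tendsto (fun ε : ℝ => (1 / ε ^ 2) * deriv (deriv ℓ) (1 / ε)) (𝓝[≠] (0 : ℝ)) (𝓝 0)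

namespace AssumptionA

variable {ℓ : ℝ → ℝ}

lemma differentiable (hA : AssumptionA ℓ) : Differentiable ℝ ℓ :=
  hA.smooth.differentiable (by norm_num)

lemma contDiff_deriv (hA : AssumptionA ℓ) : ContDiff ℝ 2 (deriv ℓ) := by
  have h : ContDiff ℝ (2 + 1) ℓ := by
    have := hA.smooth
    norm_num
    exact this
  exact (contDiff_succ_iff_deriv.mp h).2.2

lemma differentiable_deriv (hA : AssumptionA ℓ) : Differentiable ℝ (deriv ℓ) :=
  hA.contDiff_deriv.differentiable (by norm_num)

lemma continuous_deriv (hA : AssumptionA ℓ) : Continuous (deriv ℓ) :=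
  hA.contDiff_deriv.continuous

lemma strictMono_deriv (hA : AssumptionA ℓ) : StrictMono (deriv ℓ) := by
  have h := hA.strictConvex.strictMonoOn_deriv (fun x _ => hA.differentiable x)
  exact strictMonoOn_univ.mp h

lemma deriv_pos (hA : AssumptionA ℓ) (z : ℝ) : 0 < deriv ℓ z :=
  (hA.strictMono_deriv.monotone.le_of_tendsto hA.deriv_tendsto_zero_atBot (z - 1)).trans_lt
    (hA.strictMono_deriv (by linarith))

lemma deriv_deriv_nonneg (hA : AssumptionA ℓ) (z : ℝ) : 0 ≤ deriv (deriv ℓ) z :=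
  hA.strictMono_deriv.monotone.deriv_nonneg

lemma deriv_deriv_pos (hA : AssumptionA ℓ) (z : ℝ) : 0 < deriv (deriv ℓ) z := by
  rcases le_total z 0 with hz | hz
  · refine (hA.deriv_deriv_nonneg (z - 1)).trans_lt (hA.secondDeriv_strictMono ?_ hz ?_)
    · exact Set.mem_Iic.mpr (by linarith)
    · linarith
  · refine (hA.deriv_deriv_nonneg (z + 1)).trans_lt (hA.secondDeriv_strictAnti hz ?_ ?_)
    · exact Set.mem_Ici.mpr (by linarith)
    · linarith

/-- The tangent line lies below the graph. -/
lemma tangent_le (hA : AssumptionA ℓ) (x y : ℝ) : ℓ x + deriv ℓ x * (y - x) ≤ ℓ y := by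
  have hc := hA.strictConvex.convexOn
  rcases lt_trichotomy x y with h | rfl | h
  · have := hc.deriv_le_slope (Set.mem_univ x) (Set.mem_univ y) h (hA.differentiable x)
    rw [slope_def_field, le_div_iff₀ (by linarith)] at this
    linarith
  · simp
  · have := hc.slope_le_deriv (Set.mem_univ y) (Set.mem_univ x) h (hA.differentiable x)
    rw [slope_def_field, div_le_iff₀ (by linarith)] at this
    linarith

/-- A stationary point of `n ℓ(w) + m ℓ(-w)` is a global minimizer. -/
lemma le_of_stationary (hA : AssumptionA ℓ) {m n x : ℝ} (hm : 0 ≤ m) (hn : 0 ≤ n)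
    (hx : n * deriv ℓ x = m * deriv ℓ (-x)) (y : ℝ) :
    m * ℓ (-x) + n * ℓ x ≤ m * ℓ (-y) + n * ℓ y := by
  have h₁ := mul_le_mul_of_nonneg_left (hA.tangent_le x y) hn
  have h₂ := mul_le_mul_of_nonneg_left (hA.tangent_le (-x) (-y)) hm
  linear_combination h₁ + h₂ - (y - x) * hx

lemma exists_stationary (hA : AssumptionA ℓ) {c a : ℝ}
    (ha : deriv ℓ a < c * deriv ℓ (-a)) :
    ∃ w, a < w ∧ deriv ℓ w = c * deriv ℓ (-w) := by
  have hlim : Tendsto (fun w => deriv ℓ w - c * deriv ℓ (-w)) atTop (𝓝 (1 - c * 0)) :=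
    hA.deriv_tendsto_one_atTop.sub
      ((hA.deriv_tendsto_zero_atBot.comp tendsto_neg_atTop_atBot).const_mul c)
  have hpos : ∀ᶠ w in atTop, 0 < deriv ℓ w - c * deriv ℓ (-w) :=
    hlim.eventually (lt_mem_nhds (by norm_num))
  obtain ⟨b, hb, hab⟩ := (hpos.and (eventually_gt_atTop a)).exists
  have hcont : Continuous (fun w => deriv ℓ w - c * deriv ℓ (-w)) :=
    hA.continuous_deriv.sub
      (continuous_const.mul (hA.continuous_deriv.comp continuous_neg))
  obtain ⟨w, hw, hw0⟩ := intermediate_value_Ioo hab.le hcont.continuousOn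
    (show (0 : ℝ) ∈ Set.Ioo _ _ from ⟨by linarith, hb⟩)
  exact ⟨w, hw.1, by simpa [sub_eq_zero] using hw0⟩

/-- From twice a positive stationary point, a gradient step with the inverse curvature at the
stationary point does not overshoot. -/
lemma gradient_two_mul_lt (hA : AssumptionA ℓ) {m n x : ℝ} (hm : 0 < m) (hn : 0 < n)
    (hx0 : 0 < x) (hx : n * deriv ℓ x = m * deriv ℓ (-x)) :
    n * deriv ℓ (2 * x) - m * deriv ℓ (-(2 * x)) <
      x * (m * deriv (deriv ℓ) (-x) + n * deriv (deriv ℓ) x) := by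
  have hdiff := hA.differentiable_deriv
  obtain ⟨ξ, hξ, h₁⟩ := exists_deriv_eq_slope (deriv ℓ) (show x < 2 * x by linarith)
    hdiff.continuous.continuousOn hdiff.differentiableOn
  obtain ⟨ζ, hζ, h₂⟩ := exists_deriv_eq_slope (deriv ℓ) (show -(2 * x) < -x by linarith)
    hdiff.continuous.continuousOn hdiff.differentiableOn
  rw [eq_div_iff (by linarith)] at h₁ h₂
  have h₃ : deriv (deriv ℓ) ξ < deriv (deriv ℓ) x :=
    hA.secondDeriv_strictAnti (Set.mem_Ici.mpr hx0.le)
      (Set.mem_Ici.mpr (hx0.trans hξ.1).le) hξ.1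
  have h₄ : deriv (deriv ℓ) ζ < deriv (deriv ℓ) (-x) :=
    hA.secondDeriv_strictMono (Set.mem_Iic.mpr (by linarith [hζ.2]))
      (Set.mem_Iic.mpr (by linarith)) hζ.2
  have h₅ := mul_lt_mul_of_pos_left h₃ (mul_pos hn hx0)
  have h₆ := mul_lt_mul_of_pos_left h₄ (mul_pos hm hx0)
  linear_combination h₅ + h₆ - n * h₁ - m * h₂ + hx

lemma gradient_two_mul_pos (hA : AssumptionA ℓ) {m n x : ℝ} (hm : 0 < m) (hn : 0 < n)
    (hx0 : 0 < x) (hx : n * deriv ℓ x = m * deriv ℓ (-x)) :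
    0 < n * deriv ℓ (2 * x) - m * deriv ℓ (-(2 * x)) := by
  have h₁ := mul_lt_mul_of_pos_left
    (hA.strictMono_deriv (show x < 2 * x by linarith)) hn
  have h₂ := mul_lt_mul_of_pos_left
    (hA.strictMono_deriv (show -(2 * x) < -x by linarith)) hm
  linarith

end AssumptionA

lemma diagonal_two_mulVec_single (d : Fin 2 → ℝ) :
    (Matrix.diagonal d).mulVec (Pi.single 0 1) = d 0 • (Pi.single 0 1 : Fin 2 → ℝ) := by
  rw [Matrix.diagonal_mulVec_single, ← Pi.single_smul, smul_eq_mul]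

lemma eigenvalue_diagonal_two_le {d : Fin 2 → ℝ} (hd : d 1 ≤ d 0) {μ : ℝ} {v : Fin 2 → ℝ}
    (hv : v ≠ 0) (h : (Matrix.diagonal d).mulVec v = μ • v) : μ ≤ d 0 := by
  obtain ⟨i, hi⟩ := Function.ne_iff.mp hv
  have hμ := congrFun h i
  rw [Matrix.mulVec_diagonal, Pi.smul_apply, smul_eq_mul] at hμ
  have hdi : d i = μ := mul_right_cancel₀ hi hμ
  rw [← hdi]
  fin_cases i
  · exact le_rfl
  · exact hd

/-- (Crossing over in 2D.) For every `γ ∈ (0,1]` there is a choice of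
positive integers `m₁, n₁, m₂, n₂` such that, for the coordinate-decoupled objective
with minimizer `w* = (w₁*, w₂*)`, `w₁* > w₂* > 0`, and step size
`η = γ/λ_max(∇²L(w*))`, there is a point `w = (w₁,w₂)` with `w₁ > w₁*`, `w₂ > w₂*`,
`w₂*/w₁* > w₂/w₁`, for which `T(w)` satisfies `w₂*/w₁* < T(w)₂/T(w)₁` and
`T(w)₁ > w₁*`. -/
theorem cross_over_two_dim
    (ℓ : ℝ → ℝ) (hA : AssumptionA ℓ)
    (γ : ℝ) (hγ : γ ∈ Set.Ioc (0 : ℝ) 1) :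
    ∃ m₁ n₁ m₂ n₂ : ℕ, 0 < m₁ ∧ 0 < n₁ ∧ 0 < m₂ ∧ 0 < n₂ ∧
      ∃ N : ℕ, N = m₁ + n₁ + m₂ + n₂ ∧
      ∃ (L : ℝ × ℝ → ℝ) (g : ℝ × ℝ → ℝ × ℝ),
        -- the coordinate-decoupled objective
        (∀ w : ℝ × ℝ, L w = (1 / (N : ℝ)) *
          ((m₁ : ℝ) * ℓ (-w.1) + (n₁ : ℝ) * ℓ w.1 +
           (m₂ : ℝ) * ℓ (-w.2) + (n₂ : ℝ) * ℓ w.2)) ∧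
        -- its gradient
        (∀ w : ℝ × ℝ, g w =
          ((1 / (N : ℝ)) * ((n₁ : ℝ) * deriv ℓ w.1 - (m₁ : ℝ) * deriv ℓ (-w.1)),
           (1 / (N : ℝ)) * ((n₂ : ℝ) * deriv ℓ w.2 - (m₂ : ℝ) * deriv ℓ (-w.2)))) ∧
        ∃ wstar : ℝ × ℝ,
          (∀ w, L wstar ≤ L w) ∧ 0 < wstar.2 ∧ wstar.2 < wstar.1 ∧
          ∃ (H : Matrix (Fin 2) (Fin 2) ℝ) (lam : ℝ),
            -- the (diagonal) Hessian at the minimizer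
            H = Matrix.diagonal
              ![(1 / (N : ℝ)) * ((m₁ : ℝ) * deriv (deriv ℓ) (-wstar.1) +
                  (n₁ : ℝ) * deriv (deriv ℓ) wstar.1),
                (1 / (N : ℝ)) * ((m₂ : ℝ) * deriv (deriv ℓ) (-wstar.2) +
                  (n₂ : ℝ) * deriv (deriv ℓ) wstar.2)] ∧
            -- `lam` is its largest eigenvalue
            (∃ v : Fin 2 → ℝ, v ≠ 0 ∧ H.mulVec v = lam • v) ∧
            (∀ (μ : ℝ) (v : Fin 2 → ℝ), v ≠ 0 → H.mulVec v = μ • v → μ ≤ lam) ∧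
            ∃ η : ℝ, η = γ / lam ∧
            ∃ w : ℝ × ℝ,
              wstar.1 < w.1 ∧ wstar.2 < w.2 ∧ w.2 / w.1 < wstar.2 / wstar.1 ∧
              wstar.2 / wstar.1 < (w.2 - η * (g w).2) / (w.1 - η * (g w).1) ∧
              wstar.1 < w.1 - η * (g w).1 := by
  obtain ⟨hγ0, hγ1⟩ := hγ
  obtain ⟨x₂, hx₂, hs₂⟩ := hA.exists_stationary (c := 2) (a := 0) (by
    have := hA.deriv_pos 0
    rw [neg_zero]; linarith)
  obtain ⟨x₁, hx₂₁, hs₁⟩ := hA.exists_stationary (c := 3) (a := x₂) (by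
    have := hA.deriv_pos (-x₂)
    linarith)
  have hx₁ : 0 < x₁ := hx₂.trans hx₂₁
  have hs₁' : 1 * deriv ℓ x₁ = 3 * deriv ℓ (-x₁) := by linarith
  have hs₂' : 1 * deriv ℓ x₂ = 2 * deriv ℓ (-x₂) := by linarith
  have hG₁ := hA.gradient_two_mul_pos (by norm_num) (by norm_num) hx₁ hs₁'
  have hGA₁ := hA.gradient_two_mul_lt (by norm_num) (by norm_num) hx₁ hs₁'
  set G₁ := 1 * deriv ℓ (2 * x₁) - 3 * deriv ℓ (-(2 * x₁))
  set A₁ := 3 * deriv (deriv ℓ) (-x₁) + 1 * deriv (deriv ℓ) x₁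
  set G₂ := 1 * deriv ℓ (2 * x₂) - 2 * deriv ℓ (-(2 * x₂))
  set A₂ := 2 * deriv (deriv ℓ) (-x₂) + 1 * deriv (deriv ℓ) x₂
  have hA₁_pos : 0 < A₁ := by
    have := hA.deriv_deriv_pos (-x₁)
    have := hA.deriv_deriv_pos x₁
    positivity
  obtain ⟨K, hK⟩ := exists_nat_gt (max (max (A₂ / A₁) (x₁ * G₂ / (x₂ * G₁))) 0)
  obtain ⟨hK', hK0⟩ := max_lt_iff.mp hK
  obtain ⟨hKA, hKG⟩ := max_lt_iff.mp hK'
  rw [div_lt_iff₀ hA₁_pos] at hKA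
  rw [div_lt_iff₀ (mul_pos hx₂ hG₁)] at hKG
  have hKn : 0 < K := by exact_mod_cast hK0
  obtain ⟨N, hN⟩ : ∃ N : ℕ, N = 3 * K + K + 2 + 1 := ⟨_, rfl⟩
  have hN0 : (0 : ℝ) < N := by
    have : 0 < N := by omega
    exact_mod_cast this
  have hη0 : 0 < γ / (K * A₁) := by positivity
  have hstep : γ / (K * A₁) * (K * G₁) < x₁ := by
    have : γ / (K * A₁) * (K * G₁) = γ * G₁ / A₁ := by field_simp
    rw [this, div_lt_iff₀ hA₁_pos]
    nlinarith
  have hcross : x₂ * (2 * x₁ - γ / (K * A₁) * (K * G₁)) <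
      x₁ * (2 * x₂ - γ / (K * A₁) * G₂) := by
    have := mul_lt_mul_of_pos_left hKG hη0
    linarith
  have hcont : Continuous (fun u => x₁ * (u - γ / (K * A₁) *
      (1 * deriv ℓ u - 2 * deriv ℓ (-u)))) := by
    have h₁ := hA.continuous_deriv
    have h₂ := h₁.comp continuous_neg
    simp only [Function.comp_def] at h₂
    fun_prop
  have hev₁ := (hcont.tendsto (2 * x₂)).eventually (lt_mem_nhds hcross)
  have hev₂ : ∀ᶠ u in 𝓝 (2 * x₂), x₂ < u := lt_mem_nhds (by linarith)
  obtain ⟨u, ⟨hu₁, hu₂⟩, hu₃⟩ := (((hev₁.and hev₂).filter_mono nhdsWithin_le_nhds).and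
    (self_mem_nhdsWithin : Set.Iio (2 * x₂) ∈ 𝓝[<] (2 * x₂))).exists
  have hη (t : ℝ) : γ / (1 / N * (K * A₁)) * (1 / N * t) = γ / (K * A₁) * t := by
    field_simp
  have hg₁ : (K : ℝ) * deriv ℓ (2 * x₁) - ((3 * K : ℕ) : ℝ) * deriv ℓ (-(2 * x₁)) =
      K * G₁ := by
    push_cast
    ring
  refine ⟨3 * K, K, 2, 1, by omega, hKn, by norm_num, by norm_num, N, hN, _, _,
    fun _ => rfl, fun _ => rfl, (x₁, x₂), ?_, hx₂, hx₂₁, _, 1 / N * (K * A₁), rfl,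
    ?_, ?_, _, rfl, (2 * x₁, u), ?_, hu₂, ?_, ?_, ?_⟩
  · intro w
    have h₁ := hA.le_of_stationary (m := 3 * K) (n := K) (x := x₁) (by positivity) (by positivity)
      (by linear_combination (K : ℝ) * hs₁) w.1
    have h₂ := hA.le_of_stationary (by norm_num) (by norm_num) hs₂' w.2
    refine mul_le_mul_of_nonneg_left ?_ (by positivity)
    push_cast
    linarith
  · refine ⟨Pi.single 0 1, by simp, ?_⟩
    rw [diagonal_two_mulVec_single]
    congr 1
    simp only [Matrix.cons_val_zero]
    push_cast
    ring
  · intro μ v hv h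
    refine (eigenvalue_diagonal_two_le ?_ hv h).trans_eq ?_
    · simp only [Matrix.cons_val_zero, Matrix.cons_val_one]
      refine mul_le_mul_of_nonneg_left ?_ (by positivity)
      push_cast
      linarith
    · simp only [Matrix.cons_val_zero]
      push_cast
      ring
  · change x₁ < 2 * x₁
    linarith
  · change u / (2 * x₁) < x₂ / x₁
    rw [div_lt_div_iff₀ (by positivity) hx₁]
    nlinarith
  · simp only [hη, hg₁]
    push_cast
    rw [div_lt_div_iff₀ hx₁ (by linarith)]
    linarith
  · simp only [hη, hg₁]
    linarith
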